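/- Let n ≥ 1, let (π,u) ∈ Vert(C_n), let (β,w) = (ζ_C(π), d_C(π,u)), and let a, b ∈ {u(1),…,u(n)}. Then (π,u) has a rise labelled (a,b) if and only if (β,w) has a valley labelled (b,a) or a valley labelled (−a,−b). Moreover, π begins with a North step and u(1) = a if and only if (β,w) has a valley labelled (a,−a). -/

import Mathlib

inductive Step
  | N : Step
  | E : Step
  deriving DecidableEq

/-- The number of East steps strictly preceding the `k`-th North step. -/
def ebn : List Step → ℕ → ℕ
  | _, 0 => 0
  | [], _ + 1 => 0
  | Step.E :: rest, k + 1 => ebn rest (k + 1) + 1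
  | Step.N :: rest, k + 1 => ebn rest k

/-- A lattice path with `a` East steps and `b` North steps. -/
def IsLatticePath (a b : ℕ) (π : List Step) : Prop :=
  π.count Step.E = a ∧ π.count Step.N = b

/-- A ballot path of length `m`: every prefix has at least as many `N`s as `E`s. -/
def IsBallotPath (m : ℕ) (β : List Step) : Prop :=
  β.length = m ∧ ∀ k : ℕ, (β.take k).count Step.E ≤ (β.take k).count Step.N

/-- `i` is a rise: the `i`-th North step is immediately followed by a North step. -/
def IsRise (π : List Step) (i : ℕ) : Prop :=
  ∃ p : ℕ, π[p]? = some Step.N ∧ π[p + 1]? = some Step.N ∧ (π.take p).count Step.N + 1 = i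

/-- `(i,j)` is a valley: the `i`-th East step is immediately followed by the `j`-th North
step; in addition if the path ends with an East step and consists of `i` East steps and
`j - 1` North steps, then `(i, j)` counts as a valley. -/
def IsValley (β : List Step) (i j : ℕ) : Prop :=
  (∃ p : ℕ, β[p]? = some Step.E ∧ β[p + 1]? = some Step.N ∧
      (β.take p).count Step.E + 1 = i ∧ (β.take (p + 1)).count Step.N + 1 = j) ∨
  (β.getLast? = some Step.E ∧ i = β.count Step.E ∧ j = β.count Step.N + 1)

/-- Read `a` from left to right, writing `N` for each entry `j` and `E` for each entry `j+1`. -/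
def sPlusL (j : ℤ) (a : List ℤ) : List Step :=
  a.filterMap fun x => if x = j then some Step.N else if x = j + 1 then some Step.E else none

/-- Read `a` from right to left, writing `N` for each entry `j` and `E` for each entry `j+1`. -/
def sPlusR (j : ℤ) (a : List ℤ) : List Step := sPlusL j a.reverse

/-- Read `a` from left to right, writing `N` for each entry `-j` and `E` for each entry `-j-1`. -/
def sMinusL (j : ℤ) (a : List ℤ) : List Step :=
  a.filterMap fun x => if x = -j then some Step.N else if x = -j - 1 then some Step.E else none

/-- Read `a` from right to left, writing `N` for each entry `-j` and `E` for each entry `-j-1`. -/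
def sMinusR (j : ℤ) (a : List ℤ) : List Step := sMinusL j a.reverse

/-- The type `Cₙ` area vector of a lattice path, `μ k = (n+1-k) - λ_{n+1-k}` (1-based). -/
def areaC (n : ℕ) (π : List Step) (k : ℕ) : ℤ :=
  ((n : ℤ) + 1 - k) - ebn π (n + 1 - k)

def areaCList (n : ℕ) (π : List Step) : List ℤ :=
  (List.range n).map fun k => areaC n π (k + 1)

/-- The type `Cₙ` zeta map. -/
def zetaC (n : ℕ) (π : List Step) : List Step :=
  ((List.range (n + 1)).reverse.map (fun j =>
    sMinusR (j : ℤ) (areaCList n π) ++ sPlusL (j : ℤ) (areaCList n π))).flatten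

/-- `w` is the window `[w(1),…,w(n)]` of a signed permutation of rank `n`. -/
def IsSignedPerm (n : ℕ) (w : Fin n → ℤ) : Prop :=
  (∀ i, 1 ≤ |w i| ∧ |w i| ≤ (n : ℤ)) ∧ Function.Injective fun i => |w i|

/-- Evaluation of (the window of) a signed permutation at any integer, via `w(-j) = -w(j)`
and `w(0) = 0`. -/
def evalSP {n : ℕ} (w : Fin n → ℤ) (j : ℤ) : ℤ :=
  if h : 1 ≤ j ∧ j ≤ (n : ℤ) then w ⟨(j - 1).toNat, by omega⟩
  else if h' : 1 ≤ -j ∧ -j ≤ (n : ℤ) then -w ⟨(-j - 1).toNat, by omega⟩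
  else 0

/-- Vertically labelled lattice paths of type `Cₙ` (also of type `Bₙ`). -/
def VertC (n : ℕ) : Set (List Step × (Fin n → ℤ)) :=
  {p : List Step × (Fin n → ℤ) | IsLatticePath n n p.1 ∧ IsSignedPerm n p.2 ∧
    (∀ i : ℕ, IsRise p.1 i → evalSP p.2 (i : ℤ) < evalSP p.2 ((i : ℤ) + 1)) ∧
    (p.1.head? = some Step.N → 0 < evalSP p.2 1)}

/-- The diagonal reading word of type `Cₙ` as the list of its window entries. -/
def dCList (n : ℕ) (π : List Step) (w : Fin n → ℤ) : List ℤ :=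
  ((List.range (n + 1)).map (fun i =>
    ((List.finRange n).reverse.filterMap (fun j =>
      if areaC n π (n - j.val) = -(i : ℤ) then some (-(w j)) else none)) ++
    ((List.finRange n).filterMap (fun j =>
      if areaC n π (n - j.val) = (i : ℤ) + 1 then some (w j) else none)))).flatten

/-- The diagonal reading word of type `Cₙ`. -/
def dC (n : ℕ) (π : List Step) (w : Fin n → ℤ) : Fin n → ℤ :=
  fun i => (dCList n π w).getD i.val 0

/-- `(π,u)` has a rise labelled `(a, b)`. -/
def RiseLabelledC (n : ℕ) (π : List Step) (u : Fin n → ℤ) (a b : ℤ) : Prop :=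
  ∃ i : ℕ, IsRise π i ∧ a = evalSP u (i : ℤ) ∧ b = evalSP u ((i : ℤ) + 1)

/-- `(β,w)` has a valley labelled `(x, y)` (type `Cₙ` labelling convention). -/
def ValleyLabelledC (n : ℕ) (β : List Step) (w : Fin n → ℤ) (x y : ℤ) : Prop :=
  ∃ i j : ℕ, IsValley β i j ∧ x = evalSP w ((n : ℤ) + 1 - i) ∧
    y = if j ≤ n then evalSP w ((n : ℤ) + 1 - j) else evalSP w ((n : ℤ) - j)

namespace RiseValley

variable {α : Type*}

theorem eq_append_cons_cons_of_getElem? {l : List α} {k : ℕ} {x y : α} (hx : l[k]? = some x)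
    (hy : l[k + 1]? = some y) : ∃ l₁ l₂, l = l₁ ++ x :: y :: l₂ ∧ l₁.length = k := by
  obtain ⟨hk, rfl⟩ := List.getElem?_eq_some_iff.1 hx
  obtain ⟨hk', rfl⟩ := List.getElem?_eq_some_iff.1 hy
  refine ⟨l.take k, l.drop (k + 2), ?_, by simp; omega⟩
  rw [← List.drop_eq_getElem_cons hk', ← List.drop_eq_getElem_cons hk, List.take_append_drop]

/-- Two elements are consecutive in `x :: l` iff they are its first two or consecutive in `l`. -/
theorem pair_infix_cons {p q x : α} {l : List α} :
    [p, q] <:+: x :: l ↔ (x = p ∧ l.head? = some q) ∨ [p, q] <:+: l := by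
  rw [List.infix_cons_iff]
  refine or_congr_left ?_
  cases l <;> simp [List.cons_prefix_cons, eq_comm]

/-- Consecutive elements of a concatenation whose first part does not end in `p`. -/
theorem pair_infix_append {p q : α} {l₁ l₂ : List α} (h : l₁.getLast? ≠ some p) :
    [p, q] <:+: l₁ ++ l₂ ↔ [p, q] <:+: l₁ ∨ [p, q] <:+: l₂ := by
  induction l₁ with
  | nil => simp
  | cons x l ih =>
    cases l with
    | nil =>
      have hx : x ≠ p := by simpa using h
      simp [pair_infix_cons, hx]
    | cons y l =>
      rw [List.cons_append, pair_infix_cons, ih (by simpa using h), pair_infix_cons (l := y :: l)]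
      simp [or_assoc]

theorem getLast?_append_eq_iff {p : α} {l₁ l₂ : List α} (h : l₁.getLast? ≠ some p) :
    (l₁ ++ l₂).getLast? = some p ↔ l₂.getLast? = some p := by
  rw [List.getLast?_append]
  cases l₂.getLast? <;> simp [h]

theorem pair_infix_finRange {n : ℕ} {s t : Fin n} :
    [s, t] <:+: List.finRange n ↔ t.val = s.val + 1 := by
  constructor
  · rintro ⟨l₁, l₂, h⟩
    have hs : (List.finRange n)[l₁.length]? = some s := by simp [← h]
    have ht : (List.finRange n)[l₁.length + 1]? = some t := by simp [← h]
    rw [List.getElem?_eq_some_iff] at hs ht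
    obtain ⟨_, rfl⟩ := hs
    obtain ⟨_, rfl⟩ := ht
    simp
  · intro h
    obtain ⟨l₁, l₂, hl, -⟩ := eq_append_cons_cons_of_getElem? (l := List.finRange n)
      (k := s.val) (x := s) (y := t) (by simp) (by simp [← h])
    exact ⟨l₁, l₂, by simp [hl]⟩

/-- Read `l`, writing `a` for entries of level `c` and `b` for entries of level `c + 1`,
each step carrying the label `v` of its entry. -/
def levelWord (h v : α → ℤ) (c : ℤ) (a b : Step) (l : List α) : List (Step × ℤ) :=
  l.filterMap fun s =>
    if h s = c then some (a, v s) else if h s = c + 1 then some (b, v s) else none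

section levelWord

variable {h v : α → ℤ} {c : ℤ} {a b : Step} {l : List α}

theorem levelWord_head?_ne (hab : a ≠ b) (hl : l.IsChain fun s t => h t ≤ h s + 1)
    (hd : ∀ s ∈ l.head?, h s ≤ c) (y : ℤ) :
    (levelWord h v c a b l).head? ≠ some (b, y) := by
  induction l with
  | nil => simp [levelWord]
  | cons s l ih =>
    have hs : h s ≤ c := hd s (by simp)
    rw [List.isChain_cons] at hl
    by_cases hc : h s = c
    · simp [levelWord, hc, hab]
    · have := ih hl.2 fun t ht => by have := hl.1 t ht; omega
      have hc' : h s ≠ c + 1 := by omega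
      simpa [levelWord, hc, hc'] using this

theorem levelWord_ne_nil {s : α} (hl : (s :: l).IsChain fun s t => h t ≤ h s + 1)
    (hs : h s ≤ c) (hd : ∀ t ∈ (s :: l).getLast?, c + 1 ≤ h t) :
    levelWord h v c a b l ≠ [] := by
  induction l generalizing s with
  | nil => have := hd s (by simp); omega
  | cons t l ih =>
    rw [List.isChain_cons] at hl
    have ht := hl.1 t (by simp)
    by_cases hc : h t = c
    · simp [levelWord, hc]
    by_cases hc' : h t = c + 1
    · simp [levelWord, hc']
    have := ih hl.2 (by omega) (by simpa using hd)
    simpa [levelWord, hc, hc'] using this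

theorem levelWord_getLast?_ne (hab : a ≠ b) (hl : l.IsChain fun s t => h t ≤ h s + 1)
    (hd : ∀ s ∈ l.getLast?, c + 1 ≤ h s) (x : ℤ) :
    (levelWord h v c a b l).getLast? ≠ some (a, x) := by
  induction l with
  | nil => simp [levelWord]
  | cons s l ih =>
    by_cases hc : h s = c
    · have hne : levelWord h v c a b l ≠ [] := levelWord_ne_nil hl hc.le hd
      have hd' : ∀ t ∈ l.getLast?, c + 1 ≤ h t := by
        cases l with
        | nil => simp
        | cons t l => simpa using hd
      have := ih (List.isChain_cons.1 hl).2 hd'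
      have e : levelWord h v c a b (s :: l) = [(a, v s)] ++ levelWord h v c a b l := by
        simp [levelWord, hc]
      rw [e, List.getLast?_append_of_ne_nil _ hne]
      exact this
    · have ih' : (levelWord h v c a b l).getLast? ≠ some (a, x) := by
        cases l with
        | nil => simp [levelWord]
        | cons t l => exact ih (List.isChain_cons.1 hl).2 (by simpa using hd)
      by_cases hc' : h s = c + 1
      · have e : levelWord h v c a b (s :: l) = [(b, v s)] ++ levelWord h v c a b l := by
          simp [levelWord, hc']
        rw [e, List.getLast?_append]
        cases hL : (levelWord h v c a b l).getLast? with
        | none => simp [hab.symm]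
        | some q => simpa [hL] using ih'
      · simpa [levelWord, hc, hc'] using ih'

theorem pair_infix_levelWord (hab : a ≠ b) (hl : l.IsChain fun s t => h t ≤ h s + 1) {x y : ℤ} :
    [(a, x), (b, y)] <:+: levelWord h v c a b l ↔
      ∃ s t, [s, t] <:+: l ∧ h s = c ∧ h t = c + 1 ∧ x = v s ∧ y = v t := by
  induction l with
  | nil => simp [levelWord]
  | cons s l ih =>
    have ih := ih (List.isChain_cons.1 hl).2
    by_cases hc : h s = c
    · have e : levelWord h v c a b (s :: l) = (a, v s) :: levelWord h v c a b l := by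
        simp [levelWord, hc]
      rw [e, pair_infix_cons, ih]
      constructor
      · rintro (⟨h₁, h₂⟩ | ⟨s', t', h₁, h₂⟩)
        · cases l with
          | nil => simp [levelWord] at h₂
          | cons t l =>
            rw [List.isChain_cons] at hl
            have ht := hl.1 t (by simp)
            by_cases ht' : h t = c + 1
            · have : v t = y := by simpa [levelWord, ht'] using h₂
              exact ⟨s, t, by simp [pair_infix_cons], hc, ht', by simpa [eq_comm] using h₁,
                this.symm⟩
            · refine absurd h₂ (levelWord_head?_ne hab hl.2 ?_ y)
              simp
              omega
        · exact ⟨s', t', pair_infix_cons.2 (Or.inr h₁), h₂⟩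
      · rintro ⟨s', t', h₁, h₂, h₃, rfl, rfl⟩
        rcases pair_infix_cons.1 h₁ with ⟨rfl, hd⟩ | h₁
        · left
          cases l with
          | nil => simp at hd
          | cons t l =>
            obtain rfl : t = t' := by simpa using hd
            simp [levelWord, h₃]
        · exact Or.inr ⟨s', t', h₁, h₂, h₃, rfl, rfl⟩
    · have e : [(a, x), (b, y)] <:+: levelWord h v c a b (s :: l) ↔
          [(a, x), (b, y)] <:+: levelWord h v c a b l := by
        by_cases hc' : h s = c + 1
        · have e : levelWord h v c a b (s :: l) = (b, v s) :: levelWord h v c a b l := by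
            simp [levelWord, hc']
          rw [e, pair_infix_cons]
          simp [hab.symm]
        · simp [levelWord, hc, hc']
      rw [e, ih]
      refine exists₂_congr fun s' t' => ?_
      rw [pair_infix_cons]
      constructor
      · rintro ⟨h₁, h₂⟩
        exact ⟨Or.inr h₁, h₂⟩
      · rintro ⟨⟨rfl, -⟩ | h₁, h₂⟩
        · exact absurd h₂.1 hc
        · exact ⟨h₁, h₂⟩

end levelWord

/-- The labels carried by the steps of kind `s`. -/
def stepLabels (s : Step) (Z : List (Step × ℤ)) : List ℤ :=
  Z.filterMap fun q => if q.1 = s then some q.2 else none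

theorem stepLabels_append (s : Step) (Z₁ Z₂ : List (Step × ℤ)) :
    stepLabels s (Z₁ ++ Z₂) = stepLabels s Z₁ ++ stepLabels s Z₂ := List.filterMap_append

theorem length_stepLabels (s : Step) (Z : List (Step × ℤ)) :
    (stepLabels s Z).length = (Z.map Prod.fst).count s := by
  induction Z with
  | nil => simp [stepLabels]
  | cons q Z ih =>
    by_cases hq : q.1 = s <;> simp_all [stepLabels]

/-- The labels of the entries of level `c`. -/
def levelLabels (h v : α → ℤ) (c : ℤ) (l : List α) : List ℤ :=
  l.filterMap fun s => if h s = c then some (v s) else none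

theorem stepLabels_levelWord_left {h v : α → ℤ} {c : ℤ} {a b : Step} (hab : a ≠ b)
    (l : List α) : stepLabels a (levelWord h v c a b l) = levelLabels h v c l := by
  rw [stepLabels, levelWord, List.filterMap_filterMap, levelLabels]
  refine List.filterMap_congr fun s _ => ?_
  split_ifs <;> simp [hab.symm]

theorem stepLabels_levelWord_right {h v : α → ℤ} {c : ℤ} {a b : Step} (hab : a ≠ b)
    (l : List α) : stepLabels b (levelWord h v c a b l) = levelLabels h v (c + 1) l := by
  rw [stepLabels, levelWord, List.filterMap_filterMap, levelLabels]
  refine List.filterMap_congr fun s _ => ?_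
  split_ifs <;> first | omega | simp [hab]

theorem stepLabels_reverse (s : Step) (Z : List (Step × ℤ)) :
    stepLabels s Z.reverse = (stepLabels s Z).reverse := by
  simp [stepLabels, List.filterMap_reverse]

section evalSP

variable {n : ℕ}

theorem evalSP_succ (u : Fin n → ℤ) (s : Fin n) : evalSP u ((s.val : ℤ) + 1) = u s := by
  have := s.isLt
  rw [evalSP, dif_pos (by omega)]
  congr 1
  ext
  simp

theorem evalSP_neg_succ (u : Fin n → ℤ) (s : Fin n) : evalSP u (-((s.val : ℤ) + 1)) = -u s := by
  have := s.isLt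
  rw [evalSP, dif_neg (by omega), dif_pos (by omega)]
  congr 2
  ext
  simp

/-- The label attached to the `j`-th North step of a path is the `j`-th entry of the word
`w(n), …, w(1), w(-1), …, w(-n)`. -/
theorem evalSP_of_reverse_append {d l₁ l₂ : List ℤ} {y : ℤ} (hd : d.length = n)
    (h : d.reverse ++ d.map (fun z => -z) = l₁ ++ y :: l₂) :
    (if l₁.length + 1 ≤ n then
      evalSP (fun i : Fin n => d.getD i.val 0) ((n : ℤ) + 1 - (l₁.length + 1 : ℕ))
    else evalSP (fun i : Fin n => d.getD i.val 0) ((n : ℤ) - (l₁.length + 1 : ℕ))) = y := by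
  have hy : (d.reverse ++ d.map (fun z => -z))[l₁.length]? = some y := by simp [h]
  have hlen := congrArg List.length h
  simp only [List.length_append, List.length_reverse, List.length_map, List.length_cons] at hlen
  split_ifs with hj
  · have e : (n : ℤ) + 1 - (l₁.length + 1 : ℕ)
        = ((⟨n - 1 - l₁.length, by omega⟩ : Fin n).val : ℤ) + 1 := by
      simp only
      omega
    rw [e, evalSP_succ]
    rw [List.getElem?_append_left (by simp; omega), List.getElem?_reverse (by omega)] at hy
    rw [hd] at hy
    simp [hy]
  · have e : (n : ℤ) - (l₁.length + 1 : ℕ)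
        = -(((⟨l₁.length - n, by omega⟩ : Fin n).val : ℤ) + 1) := by
      simp only
      omega
    rw [e, evalSP_neg_succ]
    rw [List.getElem?_append_right (by simp; omega), List.length_reverse, hd,
      List.getElem?_map] at hy
    rw [List.getD_eq_getElem?_getD]
    cases hz : d[l₁.length - n]? with
    | none => simp [hz] at hy
    | some z => simpa [hz] using hy

theorem evalSP_of_reverse {d l₁ l₂ : List ℤ} {x : ℤ} (hd : d.length = n)
    (h : d.reverse = l₁ ++ x :: l₂) :
    evalSP (fun i : Fin n => d.getD i.val 0) ((n : ℤ) + 1 - (l₁.length + 1 : ℕ)) = x := by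
  have hlen := congrArg List.length h
  simp only [List.length_append, List.length_reverse, List.length_cons] at hlen
  have := evalSP_of_reverse_append (l₁ := l₁) (l₂ := l₂ ++ d.map (fun z => -z)) (y := x) hd
    (by simp [h])
  rwa [if_pos (by omega)] at this

/-- Valleys of a path whose steps carry the labels prescribed by the window `d`. -/
theorem valleyLabelledC_iff {d A : List ℤ} {Z : List (Step × ℤ)} (hd : d.length = n)
    (hE : stepLabels Step.E Z ++ A = d.reverse)
    (hN : stepLabels Step.N Z = d.reverse ++ A.reverse.map (fun z => -z)) (x y : ℤ) :
    ValleyLabelledC n (Z.map Prod.fst) (fun i : Fin n => d.getD i.val 0) x y ↔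
      [(Step.E, x), (Step.N, y)] <:+: Z ∨ (Z.getLast? = some (Step.E, x) ∧ y = -x) := by
  have hneg : d.map (fun z => -z) = A.reverse.map (fun z => -z) ++
      (stepLabels Step.E Z).reverse.map (fun z => -z) := by
    rw [← List.map_append, ← List.reverse_append, hE, List.reverse_reverse]
  have key : ∀ (l₁ l₂ : List (Step × ℤ)) (x' y' : ℤ),
      Z = l₁ ++ (Step.E, x') :: (Step.N, y') :: l₂ →
      evalSP (fun i : Fin n => d.getD i.val 0)
        ((n : ℤ) + 1 - ((l₁.map Prod.fst).count Step.E + 1 : ℕ)) = x' ∧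
      (if (l₁.map Prod.fst).count Step.N + 1 ≤ n then
        evalSP (fun i : Fin n => d.getD i.val 0)
          ((n : ℤ) + 1 - ((l₁.map Prod.fst).count Step.N + 1 : ℕ))
      else evalSP (fun i : Fin n => d.getD i.val 0)
          ((n : ℤ) - ((l₁.map Prod.fst).count Step.N + 1 : ℕ))) = y' := by
    intro l₁ l₂ x' y' hZ
    rw [← length_stepLabels, ← length_stepLabels]
    constructor
    · refine evalSP_of_reverse (l₂ := stepLabels Step.E l₂ ++ A) hd ?_
      rw [← hE, hZ, stepLabels_append]
      simp [stepLabels]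
    · refine evalSP_of_reverse_append
        (l₂ := stepLabels Step.N l₂ ++ (stepLabels Step.E Z).reverse.map (fun z => -z)) hd ?_
      rw [hneg, ← List.append_assoc, ← hN]
      conv_lhs => rw [hZ, stepLabels_append]
      simp [stepLabels, hZ]
  have keyLast : ∀ (l : List (Step × ℤ)) (x' : ℤ), Z = l ++ [(Step.E, x')] →
      evalSP (fun i : Fin n => d.getD i.val 0)
        ((n : ℤ) + 1 - ((Z.map Prod.fst).count Step.E : ℕ)) = x' ∧
      (if (Z.map Prod.fst).count Step.N + 1 ≤ n then
        evalSP (fun i : Fin n => d.getD i.val 0)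
          ((n : ℤ) + 1 - ((Z.map Prod.fst).count Step.N + 1 : ℕ))
      else evalSP (fun i : Fin n => d.getD i.val 0)
          ((n : ℤ) - ((Z.map Prod.fst).count Step.N + 1 : ℕ))) = -x' := by
    intro l x' hZ
    have hlab : stepLabels Step.E Z = stepLabels Step.E l ++ [x'] := by
      rw [hZ, stepLabels_append]
      simp [stepLabels]
    rw [← length_stepLabels, ← length_stepLabels]
    constructor
    · rw [hlab, List.length_append, List.length_singleton]
      refine evalSP_of_reverse (l₂ := A) hd ?_
      rw [← hE, hlab]
      simp
    · refine evalSP_of_reverse_append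
        (l₂ := (stepLabels Step.E l).reverse.map (fun z => -z)) hd ?_
      rw [hneg, ← List.append_assoc, ← hN, hlab]
      simp
  have counts : ∀ (l₁ l₂ : List (Step × ℤ)) (x' y' : ℤ),
      Z = l₁ ++ (Step.E, x') :: (Step.N, y') :: l₂ →
      ((Z.map Prod.fst).take l₁.length).count Step.E = (l₁.map Prod.fst).count Step.E ∧
      ((Z.map Prod.fst).take (l₁.length + 1)).count Step.N
        = (l₁.map Prod.fst).count Step.N := by
    rintro l₁ l₂ x' y' rfl
    constructor
    · simp
    · simp [List.take_append, List.take_of_length_le]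
  constructor
  · rintro ⟨i, j, (⟨p, hp₁, hp₂, rfl, rfl⟩ | ⟨hlast, rfl, rfl⟩), rfl, rfl⟩
    · left
      rw [List.getElem?_map, Option.map_eq_some_iff] at hp₁ hp₂
      obtain ⟨⟨_, x'⟩, hp₁, rfl⟩ := hp₁
      obtain ⟨⟨_, y'⟩, hp₂, rfl⟩ := hp₂
      obtain ⟨l₁, l₂, hZ, rfl⟩ := eq_append_cons_cons_of_getElem? hp₁ hp₂
      obtain ⟨hx, hy⟩ := key l₁ l₂ x' y' hZ
      obtain ⟨cE, cN⟩ := counts l₁ l₂ x' y' hZ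
      rw [cE, cN, hx, hy]
      exact ⟨l₁, l₂, by simp [hZ]⟩
    · right
      rw [List.getLast?_map, Option.map_eq_some_iff] at hlast
      obtain ⟨⟨_, x'⟩, hlast, rfl⟩ := hlast
      obtain ⟨l, hZ⟩ := List.getLast?_eq_some_iff.1 hlast
      obtain ⟨hx, hy⟩ := keyLast l x' hZ
      rw [hx, hy]
      exact ⟨hlast, rfl⟩
  · rintro (⟨l₁, l₂, hZ⟩ | ⟨hlast, rfl⟩)
    · have hZ : Z = l₁ ++ (Step.E, x) :: (Step.N, y) :: l₂ := by simp [← hZ]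
      obtain ⟨hx, hy⟩ := key l₁ l₂ x y hZ
      obtain ⟨cE, cN⟩ := counts l₁ l₂ x y hZ
      refine ⟨(l₁.map Prod.fst).count Step.E + 1, (l₁.map Prod.fst).count Step.N + 1,
        Or.inl ⟨l₁.length, ?_, ?_, by rw [cE], by rw [cN]⟩, hx.symm, hy.symm⟩ <;> simp [hZ]
    · obtain ⟨l, hZ⟩ := List.getLast?_eq_some_iff.1 hlast
      obtain ⟨hx, hy⟩ := keyLast l x hZ
      exact ⟨_, _, Or.inr ⟨by simp [hZ], rfl, rfl⟩, hx.symm, hy.symm⟩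

end evalSP

section zetaWord

variable {n : ℕ}

/-- The part of the type `Cₙ` zeta map at diagonal `i`, each step carrying the signed label
of the area vector entry it comes from. -/
def zetaBlock (h u : Fin n → ℤ) (i : ℕ) : List (Step × ℤ) :=
  levelWord h (fun s => -u s) (-i - 1) Step.E Step.N (List.finRange n) ++
    (levelWord h u i Step.N Step.E (List.finRange n)).reverse

/-- The labelled blocks of the diagonals `m - 1, …, 0`. -/
def zetaWord (h u : Fin n → ℤ) (m : ℕ) : List (Step × ℤ) :=
  ((List.range m).reverse.map (zetaBlock h u)).flatten

/-- The entries of the diagonal reading word coming from the diagonals `0, …, m - 1`. -/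
def diagWord (h u : Fin n → ℤ) (m : ℕ) : List ℤ :=
  ((List.range m).map fun i : ℕ =>
    (levelLabels h (fun s => -u s) (-i) (List.finRange n)).reverse ++
      levelLabels h u (i + 1) (List.finRange n)).flatten

variable {h u : Fin n → ℤ}

theorem zetaWord_succ (m : ℕ) : zetaWord h u (m + 1) = zetaBlock h u m ++ zetaWord h u m := by
  simp [zetaWord, List.range_succ]

theorem diagWord_succ (m : ℕ) : diagWord h u (m + 1) = diagWord h u m ++
    ((levelLabels h (fun s => -u s) (-m) (List.finRange n)).reverse ++
      levelLabels h u (m + 1) (List.finRange n)) := by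
  simp [diagWord, List.range_succ]

theorem stepLabels_E_zetaWord (m : ℕ) :
    stepLabels Step.E (zetaWord h u m) ++ levelLabels h (fun s => -u s) 0 (List.finRange n) =
      levelLabels h (fun s => -u s) (-m) (List.finRange n) ++ (diagWord h u m).reverse := by
  induction m with
  | zero => simp [zetaWord, diagWord, stepLabels]
  | succ m ih =>
    rw [zetaWord_succ, stepLabels_append, List.append_assoc, ih, zetaBlock, stepLabels_append,
      stepLabels_reverse, stepLabels_levelWord_left (by decide),
      stepLabels_levelWord_right (by decide), diagWord_succ]
    have e : (-(m : ℤ) - 1) = -((m + 1 : ℕ) : ℤ) := by push_cast; ring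
    simp [e]

theorem stepLabels_N_zetaWord (m : ℕ) :
    (levelLabels h u m (List.finRange n)).reverse ++ stepLabels Step.N (zetaWord h u m) =
      (diagWord h u m).reverse ++ (levelLabels h u 0 (List.finRange n)).reverse := by
  induction m with
  | zero => simp [zetaWord, diagWord, stepLabels]
  | succ m ih =>
    rw [zetaWord_succ, stepLabels_append, zetaBlock, stepLabels_append,
      stepLabels_reverse, stepLabels_levelWord_left (by decide),
      stepLabels_levelWord_right (by decide), diagWord_succ, List.append_assoc, ih]
    simp

theorem length_levelLabels (h v : α → ℤ) (c : ℤ) (l : List α) :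
    (levelLabels h v c l).length = l.countP fun s => h s = c := by
  rw [levelLabels, List.length_filterMap_eq_countP]
  refine List.countP_congr fun s _ => ?_
  split_ifs <;> simp_all

theorem length_diagWord (m : ℕ) : (diagWord h u m).length =
    (List.finRange n).countP fun s => -(m : ℤ) < h s ∧ h s ≤ m := by
  induction m with
  | zero =>
    symm
    simp [diagWord, List.countP_eq_zero]
  | succ m ih =>
    rw [diagWord_succ, List.length_append, List.length_append, List.length_reverse,
      length_levelLabels, length_levelLabels, ih]
    generalize List.finRange n = l
    induction l with
    | nil => simp
    | cons s l ih =>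
      simp only [List.countP_cons, decide_eq_true_eq]
      rw [← ih]
      push_cast
      split_ifs <;> omega

theorem levelLabels_eq_nil {h v : α → ℤ} {c : ℤ} {l : List α} (hc : ∀ s, h s ≠ c) :
    levelLabels h v c l = [] := by
  simp [levelLabels, hc]

/-- The valleys of the labelled zeta word, in terms of its consecutive steps. -/
theorem valleyLabelledC_zetaWord (hlo : ∀ s, -(n : ℤ) ≤ h s) (hhi : ∀ s, h s ≤ n) (x y : ℤ) :
    ValleyLabelledC n ((zetaWord h u (n + 1)).map Prod.fst)
        (fun i : Fin n => (diagWord h u (n + 1)).getD i.val 0) x y ↔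
      [(Step.E, x), (Step.N, y)] <:+: zetaWord h u (n + 1) ∨
        ((zetaWord h u (n + 1)).getLast? = some (Step.E, x) ∧ y = -x) := by
  refine valleyLabelledC_iff (A := levelLabels h (fun s => -u s) 0 (List.finRange n)) ?_ ?_ ?_ x y
  · rw [length_diagWord, List.countP_eq_length.2, List.length_finRange]
    intro s _
    have := hlo s
    have := hhi s
    simp
    omega
  · rw [stepLabels_E_zetaWord, levelLabels_eq_nil, List.nil_append]
    intro s
    have := hlo s
    push_cast
    omega
  · have e := stepLabels_N_zetaWord (h := h) (u := u) (n + 1)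
    rw [levelLabels_eq_nil (c := ((n + 1 : ℕ) : ℤ)) fun s => by
      have := hhi s; push_cast; omega] at e
    rw [List.reverse_nil, List.nil_append] at e
    rw [e, List.map_reverse, levelLabels, levelLabels, List.map_filterMap]
    congr 2
    refine List.filterMap_congr fun s _ => ?_
    split_ifs <;> simp

theorem isChain_finRange (hc : ∀ s t : Fin n, t.val = s.val + 1 → h t ≤ h s + 1) :
    (List.finRange n).IsChain fun s t => h t ≤ h s + 1 := by
  rw [List.isChain_iff_getElem]
  intro i hi
  exact hc _ _ (by simp)

theorem getLast?_levelWord_E_ne (hc : ∀ s t : Fin n, t.val = s.val + 1 → h t ≤ h s + 1)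
    (hlast : ∀ s : Fin n, s.val + 1 = n → 0 ≤ h s) (v : Fin n → ℤ) (i : ℕ) (x : ℤ) :
    (levelWord h v (-i - 1) Step.E Step.N (List.finRange n)).getLast? ≠ some (Step.E, x) := by
  refine levelWord_getLast?_ne (by decide) (isChain_finRange hc) (fun s hs => ?_) x
  have : 0 ≤ h s := by
    refine hlast s ?_
    rw [Option.mem_def, List.getLast?_eq_getElem?, List.getElem?_eq_some_iff] at hs
    obtain ⟨hs', rfl⟩ := hs
    simp at hs' ⊢
    omega
  omega

theorem mem_head?_finRange {s : Fin n} : s ∈ (List.finRange n).head? ↔ s.val = 0 := by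
  rw [Option.mem_def, List.head?_eq_getElem?, List.getElem?_eq_some_iff]
  constructor
  · rintro ⟨hs, rfl⟩
    simp
  · intro hs
    refine ⟨by simpa using s.pos, ?_⟩
    ext
    simp [hs]

theorem getLast?_zetaBlock_succ_ne (hc : ∀ s t : Fin n, t.val = s.val + 1 → h t ≤ h s + 1)
    (hfirst : ∀ s : Fin n, s.val = 0 → h s ≤ 1)
    (hlast : ∀ s : Fin n, s.val + 1 = n → 0 ≤ h s) (i : ℕ) (x : ℤ) :
    (zetaBlock h u (i + 1)).getLast? ≠ some (Step.E, x) := by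
  rw [zetaBlock, Ne, getLast?_append_eq_iff (getLast?_levelWord_E_ne hc hlast _ _ x),
    List.getLast?_reverse]
  refine levelWord_head?_ne (by decide) (isChain_finRange hc) (fun s hs => ?_) x
  have := hfirst s (mem_head?_finRange.1 hs)
  push_cast
  omega

theorem getLast?_zetaWord (hc : ∀ s t : Fin n, t.val = s.val + 1 → h t ≤ h s + 1)
    (hfirst : ∀ s : Fin n, s.val = 0 → h s ≤ 1)
    (hlast : ∀ s : Fin n, s.val + 1 = n → 0 ≤ h s) (m : ℕ) (x : ℤ) :
    (zetaWord h u (m + 1)).getLast? = some (Step.E, x) ↔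
      ∃ s : Fin n, s.val = 0 ∧ h s = 1 ∧ x = u s := by
  induction m with
  | zero =>
    have e : zetaWord h u (0 + 1) = zetaBlock h u 0 := by simp [zetaWord]
    rw [e, zetaBlock, getLast?_append_eq_iff (getLast?_levelWord_E_ne hc hlast _ _ x),
      List.getLast?_reverse]
    have hch := isChain_finRange hc
    have hmem := fun s => @mem_head?_finRange n s
    revert hch hmem
    generalize List.finRange n = l
    intro hch hmem
    constructor
    · intro hx
      cases l with
      | nil => simp [levelWord] at hx
      | cons s l =>
        have hs : s.val = 0 := (hmem s).1 (by simp)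
        have hs₁ : h s = 1 := by
          by_contra hne
          have := hfirst s hs
          refine levelWord_head?_ne (by decide) hch (fun t ht => ?_) x hx
          obtain rfl : s = t := by simpa using ht
          simp
          omega
        exact ⟨s, hs, hs₁, by simpa [levelWord, hs₁, eq_comm] using hx⟩
    · rintro ⟨s, hs, hs₁, rfl⟩
      have := (hmem s).2 hs
      cases l with
      | nil => simp at this
      | cons t l =>
        obtain rfl : t = s := by simpa using this
        simp [levelWord, hs₁]
  | succ m ih =>
    rw [zetaWord_succ, getLast?_append_eq_iff (getLast?_zetaBlock_succ_ne hc hfirst hlast m x), ih]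

theorem pair_infix_zetaBlock (hc : ∀ s t : Fin n, t.val = s.val + 1 → h t ≤ h s + 1)
    (hlast : ∀ s : Fin n, s.val + 1 = n → 0 ≤ h s) (i : ℕ) (x y : ℤ) :
    [(Step.E, x), (Step.N, y)] <:+: zetaBlock h u i ↔
      ∃ s t : Fin n, t.val = s.val + 1 ∧ h t = h s + 1 ∧
        ((h s = -i - 1 ∧ x = -u s ∧ y = -u t) ∨ (h s = i ∧ x = u t ∧ y = u s)) := by
  rw [zetaBlock, pair_infix_append (getLast?_levelWord_E_ne hc hlast _ _ x),
    pair_infix_levelWord (by decide) (isChain_finRange hc), ← List.reverse_infix,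
    List.reverse_reverse]
  simp only [List.reverse_cons, List.reverse_nil, List.nil_append, List.cons_append]
  rw [pair_infix_levelWord (by decide) (isChain_finRange hc)]
  simp only [pair_infix_finRange, ← exists_or]
  refine exists₂_congr fun s t => ?_
  constructor
  · rintro (⟨h₁, h₂, h₃, h₄⟩ | ⟨h₁, h₂, h₃, h₄, h₅⟩)
    · exact ⟨h₁, by omega, Or.inl ⟨h₂, h₄⟩⟩
    · exact ⟨h₁, by omega, Or.inr ⟨h₂, h₅, h₄⟩⟩
  · rintro ⟨h₁, h₂, ⟨h₃, h₄⟩ | ⟨h₃, h₄, h₅⟩⟩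
    · exact Or.inl ⟨h₁, h₃, by omega, h₄⟩
    · exact Or.inr ⟨h₁, h₃, by omega, h₅, h₄⟩

theorem pair_infix_zetaWord (hc : ∀ s t : Fin n, t.val = s.val + 1 → h t ≤ h s + 1)
    (hfirst : ∀ s : Fin n, s.val = 0 → h s ≤ 1)
    (hlast : ∀ s : Fin n, s.val + 1 = n → 0 ≤ h s) (m : ℕ) (x y : ℤ) :
    [(Step.E, x), (Step.N, y)] <:+: zetaWord h u (m + 1) ↔
      ∃ i ≤ m, [(Step.E, x), (Step.N, y)] <:+: zetaBlock h u i := by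
  induction m with
  | zero =>
    have e : zetaWord h u (0 + 1) = zetaBlock h u 0 := by simp [zetaWord]
    simp [e]
  | succ m ih =>
    rw [zetaWord_succ, pair_infix_append (getLast?_zetaBlock_succ_ne hc hfirst hlast m _), ih]
    constructor
    · rintro (hi | ⟨i, hi, hi'⟩)
      · exact ⟨m + 1, le_rfl, hi⟩
      · exact ⟨i, by omega, hi'⟩
    · rintro ⟨i, hi, hi'⟩
      rcases hi.eq_or_lt with rfl | hi
      · exact Or.inl hi'
      · exact Or.inr ⟨i, by omega, hi'⟩

/-- The three kinds of valleys of the labelled zeta word. -/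
theorem valleyLabelledC_zetaWord_iff (hlo : ∀ s, -(n : ℤ) ≤ h s) (hhi : ∀ s, h s ≤ n)
    (hc : ∀ s t : Fin n, t.val = s.val + 1 → h t ≤ h s + 1)
    (hfirst : ∀ s : Fin n, s.val = 0 → h s ≤ 1)
    (hlast : ∀ s : Fin n, s.val + 1 = n → 0 ≤ h s) (x y : ℤ) :
    ValleyLabelledC n ((zetaWord h u (n + 1)).map Prod.fst)
        (fun i : Fin n => (diagWord h u (n + 1)).getD i.val 0) x y ↔
      (∃ s t : Fin n, t.val = s.val + 1 ∧ h t = h s + 1 ∧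
        ((h s < 0 ∧ x = -u s ∧ y = -u t) ∨ (0 ≤ h s ∧ x = u t ∧ y = u s))) ∨
      (∃ s : Fin n, s.val = 0 ∧ h s = 1 ∧ x = u s ∧ y = -u s) := by
  rw [valleyLabelledC_zetaWord hlo hhi, pair_infix_zetaWord hc hfirst hlast,
    getLast?_zetaWord hc hfirst hlast]
  simp only [pair_infix_zetaBlock hc hlast]
  refine or_congr ?_ ?_
  · constructor
    · rintro ⟨i, hi, s, t, hst, hh, ⟨hs, hxy⟩ | ⟨hs, hxy⟩⟩
      · exact ⟨s, t, hst, hh, Or.inl ⟨by omega, hxy⟩⟩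
      · exact ⟨s, t, hst, hh, Or.inr ⟨by omega, hxy⟩⟩
    · rintro ⟨s, t, hst, hh, ⟨hs, hxy⟩ | ⟨hs, hxy⟩⟩
      · have := hlo s
        exact ⟨(-h s - 1).toNat, by omega, s, t, hst, hh, Or.inl ⟨by omega, hxy⟩⟩
      · have := hhi s
        exact ⟨(h s).toNat, by omega, s, t, hst, hh, Or.inr ⟨by omega, hxy⟩⟩
  · constructor
    · rintro ⟨⟨s, h₁, h₂, rfl⟩, rfl⟩
      exact ⟨s, h₁, h₂, rfl, rfl⟩
    · rintro ⟨s, h₁, h₂, rfl, rfl⟩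
      exact ⟨⟨s, h₁, h₂, rfl⟩, rfl⟩

end zetaWord

section latticePath

theorem ebn_le_ebn_succ (π : List Step) (k : ℕ) : ebn π k ≤ ebn π (k + 1) := by
  induction π generalizing k with
  | nil => cases k <;> simp [ebn]
  | cons s π ih =>
    cases s <;> cases k <;> simp [ebn, ih]

theorem ebn_le_count (π : List Step) (k : ℕ) : ebn π k ≤ π.count Step.E := by
  induction π generalizing k with
  | nil => cases k <;> simp [ebn]
  | cons s π ih =>
    cases s <;> cases k <;> simp [ebn, ih]

theorem head?_eq_N_iff {π : List Step} (hN : 0 < π.count Step.N) :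
    π.head? = some Step.N ↔ ebn π 1 = 0 := by
  rcases π with _ | ⟨_ | _, π⟩ <;> simp [ebn] at hN ⊢

theorem isRise_cons_E {π : List Step} {i : ℕ} : IsRise (Step.E :: π) i ↔ IsRise π i := by
  constructor
  · rintro ⟨_ | p, h₁, h₂, rfl⟩
    · simp at h₁
    · exact ⟨p, by simpa using h₁, by simpa using h₂, by simp⟩
  · rintro ⟨p, h₁, h₂, rfl⟩
    exact ⟨p + 1, by simpa using h₁, by simpa using h₂, by simp⟩

theorem isRise_cons_N {π : List Step} {i : ℕ} : IsRise (Step.N :: π) (i + 1) ↔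
    (i = 0 ∧ π.head? = some Step.N) ∨ IsRise π i := by
  constructor
  · rintro ⟨_ | p, h₁, h₂, h₃⟩
    · exact Or.inl ⟨by simpa using h₃.symm, by simpa [List.head?_eq_getElem?] using h₂⟩
    · exact Or.inr ⟨p, by simpa using h₁, by simpa using h₂, by simpa using h₃⟩
  · rintro (⟨rfl, h⟩ | ⟨p, h₁, h₂, rfl⟩)
    · exact ⟨0, by simp, by simpa [List.head?_eq_getElem?] using h, by simp⟩
    · exact ⟨p + 1, by simpa using h₁, by simpa using h₂, by simp⟩

theorem isRise_iff {π : List Step} {i : ℕ} :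
    IsRise π i ↔ 1 ≤ i ∧ i + 1 ≤ π.count Step.N ∧ ebn π i = ebn π (i + 1) := by
  induction π generalizing i with
  | nil => simp [IsRise]
  | cons s π ih =>
    cases s with
    | E =>
      rw [isRise_cons_E, ih]
      cases i <;> simp [ebn]
    | N =>
      cases i with
      | zero => simp [IsRise]
      | succ i =>
        rw [isRise_cons_N, ih]
        cases i with
        | zero =>
          by_cases hN : 0 < π.count Step.N
          · simp [head?_eq_N_iff hN, ebn, eq_comm]
            exact fun _ => List.count_pos_iff.1 hN
          · have : π.head? ≠ some Step.N := by
              intro h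
              refine hN (List.count_pos_iff.2 (List.mem_of_mem_head? h))
            simp [this]
            exact fun hmem => absurd (List.count_pos_iff.2 hmem) hN
        | succ i => simp [ebn]

variable {n : ℕ}

/-- The area vector entry in the row of the `(s+1)`-st North step. -/
def rowLevel (n : ℕ) (π : List Step) (s : Fin n) : ℤ := areaC n π (n - s.val)

theorem rowLevel_eq (π : List Step) (s : Fin n) :
    rowLevel n π s = s.val + 1 - ebn π (s.val + 1) := by
  have := s.isLt
  have e : n + 1 - (n - s.val) = s.val + 1 := by omega
  rw [rowLevel, areaC, e]
  omega

theorem riseLabelledC_iff {π : List Step} (hN : π.count Step.N = n) (u : Fin n → ℤ) (a b : ℤ) :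
    RiseLabelledC n π u a b ↔ ∃ s t : Fin n, t.val = s.val + 1 ∧
      rowLevel n π t = rowLevel n π s + 1 ∧ a = u s ∧ b = u t := by
  simp only [rowLevel_eq]
  constructor
  · rintro ⟨i, hi, rfl, rfl⟩
    obtain ⟨h₁, h₂, h₃⟩ := isRise_iff.1 hi
    obtain ⟨i, rfl⟩ : ∃ k, i = k + 1 := ⟨i - 1, by omega⟩
    refine ⟨⟨i, by omega⟩, ⟨i + 1, by omega⟩, rfl, ?_, ?_, ?_⟩
    · simp only [h₃]
      push_cast
      ring
    · rw [← evalSP_succ u]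
      push_cast
      rfl
    · rw [← evalSP_succ u]
  · rintro ⟨s, t, hst, hh, rfl, rfl⟩
    have := t.isLt
    refine ⟨s.val + 1, isRise_iff.2 ⟨by omega, by omega, ?_⟩, ?_, ?_⟩
    · rw [hst] at hh
      push_cast at hh
      omega
    · rw [← evalSP_succ u s]
      push_cast
      rfl
    · rw [← evalSP_succ u t, hst]

theorem areaCList_reverse (n : ℕ) (π : List Step) :
    (areaCList n π).reverse = (List.finRange n).map (rowLevel n π) := by
  refine List.ext_getElem (by simp [areaCList]) fun i h₁ h₂ => ?_
  simp [areaCList] at h₁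
  simp [areaCList, rowLevel]
  congr 1
  omega

theorem zetaC_eq (π : List Step) (u : Fin n → ℤ) :
    zetaC n π = (zetaWord (rowLevel n π) u (n + 1)).map Prod.fst := by
  rw [zetaC, zetaWord, List.map_flatten, List.map_map]
  simp only [List.pure_def, List.bind_eq_flatMap, ← List.map_eq_flatMap, List.map_map]
  congr 1
  refine List.map_congr_left fun i _ => ?_
  have e : areaCList n π = ((List.finRange n).map (rowLevel n π)).reverse := by
    rw [← areaCList_reverse, List.reverse_reverse]
  simp only [Function.comp_apply, zetaBlock, List.map_append, List.map_reverse]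
  congr 1
  · rw [sMinusR, areaCList_reverse, sMinusL, levelWord, List.filterMap_map, List.map_filterMap]
    refine List.filterMap_congr fun s _ => ?_
    simp only [Function.comp_apply]
    split_ifs <;> first | omega | rfl
  · rw [e, sPlusL, levelWord, List.filterMap_reverse, List.filterMap_map, List.map_filterMap]
    congr 1
    refine List.filterMap_congr fun s _ => ?_
    simp only [Function.comp_apply]
    split_ifs <;> rfl

theorem dCList_eq (π : List Step) (u : Fin n → ℤ) :
    dCList n π u = diagWord (rowLevel n π) u (n + 1) := by
  rw [dCList]
  simp only [List.pure_def, List.bind_eq_flatMap, ← List.map_eq_flatMap, List.map_map]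
  simp [diagWord, levelLabels, rowLevel, List.filterMap_reverse, Function.comp_def]
  rfl

/-- The valleys of the image of a vertically labelled path under zeta map and reading word. -/
theorem valleyLabelledC_zetaC_iff {π : List Step} (hπ : IsLatticePath n n π) (u : Fin n → ℤ)
    (x y : ℤ) : ValleyLabelledC n (zetaC n π) (dC n π u) x y ↔
      (∃ s t : Fin n, t.val = s.val + 1 ∧ rowLevel n π t = rowLevel n π s + 1 ∧
        ((rowLevel n π s < 0 ∧ x = -u s ∧ y = -u t) ∨
          (0 ≤ rowLevel n π s ∧ x = u t ∧ y = u s))) ∨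
      (∃ s : Fin n, s.val = 0 ∧ rowLevel n π s = 1 ∧ x = u s ∧ y = -u s) := by
  have hd : dC n π u = fun i : Fin n => (diagWord (rowLevel n π) u (n + 1)).getD i.val 0 := by
    funext i
    rw [dC, dCList_eq]
  have hle : ∀ k, ebn π k ≤ n := fun k => (ebn_le_count π k).trans hπ.1.le
  rw [zetaC_eq π u, hd]
  apply valleyLabelledC_zetaWord_iff
  · intro s
    have := hle (s.val + 1)
    rw [rowLevel_eq]
    omega
  · intro s
    have := s.isLt
    rw [rowLevel_eq]
    omega
  · intro s t hst
    have := ebn_le_ebn_succ π (s.val + 1)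
    rw [rowLevel_eq, rowLevel_eq, hst]
    push_cast
    omega
  · intro s hs
    rw [rowLevel_eq]
    omega
  · intro s hs
    have := hle (s.val + 1)
    rw [rowLevel_eq]
    omega

end latticePath

theorem IsSignedPerm.ne_neg {n : ℕ} {u : Fin n → ℤ} (hu : IsSignedPerm n u) (s t : Fin n) :
    u s ≠ -u t := by
  intro h
  obtain rfl : s = t := hu.2 (by simp [h])
  have h₀ : u s = 0 := by omega
  have := (hu.1 s).1
  simp [h₀] at this

end RiseValley

open RiseValley

/-- Rises of `(π,u)` labelled `(a,b)` correspond to valleys of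
`(ζ_C(π), d_C(π,u))` labelled `(b,a)` or `(-a,-b)`; and `π` begins with a North step
labelled `a` iff `(ζ_C(π), d_C(π,u))` has a valley labelled `(a,-a)`. -/
theorem riseValleyC (n : ℕ) (hn : 1 ≤ n) (π : List Step) (u : Fin n → ℤ)
    (hmem : (π, u) ∈ VertC n) (a b : ℤ) (ha : ∃ i, u i = a) (hb : ∃ i, u i = b) :
    (RiseLabelledC n π u a b ↔
      (ValleyLabelledC n (zetaC n π) (dC n π u) b a ∨
        ValleyLabelledC n (zetaC n π) (dC n π u) (-a) (-b))) ∧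
    ((π.head? = some Step.N ∧ evalSP u 1 = a) ↔
      ValleyLabelledC n (zetaC n π) (dC n π u) a (-a)) := by
  obtain ⟨hπ, hu, -, -⟩ := hmem
  obtain ⟨p, rfl⟩ := ha
  obtain ⟨q, rfl⟩ := hb
  have hne := hu.ne_neg
  simp only [valleyLabelledC_zetaC_iff hπ, riseLabelledC_iff hπ.2]
  refine ⟨⟨?_, ?_⟩, ?_, ?_⟩
  · rintro ⟨s, t, hst, hh, hp, hq⟩
    rcases lt_or_ge (rowLevel n π s) 0 with hs | hs
    · exact Or.inr (Or.inl ⟨s, t, hst, hh, Or.inl ⟨hs, by rw [hp], by rw [hq]⟩⟩)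
    · exact Or.inl (Or.inl ⟨s, t, hst, hh, Or.inr ⟨hs, hq, hp⟩⟩)
  · rintro ((⟨s, t, hst, hh, ⟨-, hx, hy⟩ | ⟨-, hx, hy⟩⟩ | ⟨s, -, -, hx, hy⟩) |
      (⟨s, t, hst, hh, ⟨-, hx, hy⟩ | ⟨-, hx, hy⟩⟩ | ⟨s, -, -, hx, hy⟩))
    · exact absurd hx (hne _ _)
    · exact ⟨s, t, hst, hh, hy, hx⟩
    · exact absurd hy (hne _ _)
    · exact ⟨s, t, hst, hh, by omega, by omega⟩
    · exact absurd hx.symm (hne _ _)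
    · exact absurd hx.symm (hne _ _)
  · rintro ⟨hhead, hp⟩
    have hs := evalSP_succ u ⟨0, hn⟩
    refine Or.inr ⟨⟨0, hn⟩, rfl, ?_, ?_, ?_⟩
    · have := (head?_eq_N_iff (by rw [hπ.2]; exact hn)).1 hhead
      simp [rowLevel_eq, this]
    · rw [← hp, ← hs]
      rfl
    · rw [← hp, ← hs]
      rfl
  · rintro (⟨s, t, hst, hh, ⟨-, hx, hy⟩ | ⟨-, hx, hy⟩⟩ | ⟨s, hs, hh, hx, hy⟩)
    · exact absurd hx (hne _ _)
    · exact absurd hy.symm (hne _ _)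
    · constructor
      · rw [head?_eq_N_iff (by rw [hπ.2]; exact hn)]
        rw [rowLevel_eq, hs] at hh
        push_cast at hh
        omega
      · rw [hx, ← evalSP_succ u, hs]
        rfl
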